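/- arXiv:2306.12344 — 5 statements merged into one kernel-verified Lean document; each statement's English description precedes it below -/
import Mathlib

section
/- Let N and D be positive integers with N ≥ D, let x_1, …, x_N ∈ ℝ^D be points in general position, and let l_1, …, l_N ∈ {−1, +1} be labels. For w ∈ ℝ^D with w ≠ 0 and b ∈ ℝ, define the 0-1 loss E(w, b) = #{n : ⟨w, x_n⟩ + b ≠ 0 and sign(⟨w, x_n⟩ + b) ≠ l_n} (points lying exactly on the hyperplane ⟨w, x⟩ + b = 0 are counted as correctly classified). Then there exist w ∈ ℝ^D with w ≠ 0, b ∈ ℝ, and a subset S ⊆ {1, …, N} with |S| = D such that ⟨w, x_n⟩ + b = 0 for every n ∈ S and E(w, b) = min over all (w', b') with w' ≠ 0 of E(w', b'). That is, the global minimum of the 0-1 loss is attained by an (appropriately oriented) hyperplane passing through D of the N data points. -/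
/-- The 0-1 loss of the oriented affine hyperplane `(w, b)` on the dataset `x` with
labels `l`: the number of indices `n` with `⟨w, x n⟩ + b ≠ 0` whose predicted sign
disagrees with the label `l n` (points lying exactly on the hyperplane are counted
as correctly classified). -/
noncomputable def loss01 {N D : ℕ} (x : Fin N → Fin D → ℝ) (l : Fin N → ℝ)
    (w : Fin D → ℝ) (b : ℝ) : ℕ :=
  {n : Fin N | (∑ i, w i * x n i) + b ≠ 0 ∧
    Real.sign ((∑ i, w i * x n i) + b) ≠ l n}.ncard

/-- Fewer than `D + 1` points of `ℝ^D` are always common zeros of a nonzero affine functional. -/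
theorem exists_affine_functional_vanishing_on {N D : ℕ} (x : Fin N → Fin D → ℝ)
    (T : Finset (Fin N)) (hT : T.card ≤ D) :
    ∃ (w : Fin D → ℝ) (b : ℝ), (w ≠ 0 ∨ b ≠ 0) ∧
      ∀ n ∈ T, (∑ i, w i * x n i) + b = 0 := by
  let φ : ((Fin D → ℝ) × ℝ) →ₗ[ℝ] (T → ℝ) :=
    { toFun := fun p n => (∑ i, p.1 i * x n i) + p.2
      map_add' := fun p q => by
        ext n
        simp only [Prod.fst_add, Prod.snd_add, Pi.add_apply, add_mul, Finset.sum_add_distrib]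
        ring
      map_smul' := fun c p => by
        ext n
        simp only [Prod.smul_fst, Prod.smul_snd, Pi.smul_apply, smul_eq_mul, RingHom.id_apply,
          mul_add, Finset.mul_sum, mul_assoc] }
  have hlt : Module.finrank ℝ (T → ℝ) < Module.finrank ℝ ((Fin D → ℝ) × ℝ) := by
    simp
    omega
  obtain ⟨p, hp, hp0⟩ := Submodule.exists_mem_ne_zero_of_ne_bot
    (LinearMap.ker_ne_bot_of_finrank_lt (f := φ) hlt)
  refine ⟨p.1, p.2, ?_, fun n hn => congrFun (LinearMap.mem_ker.mp hp) ⟨n, hn⟩⟩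
  by_contra! h
  exact hp0 (Prod.ext h.1 h.2)

/-- A hyperplane through fewer than `D` of the points can be replaced by one through strictly
more of them, without increasing the 0-1 loss. -/
theorem exists_loss01_le_card_zeros_lt {N D : ℕ} (hND : D ≤ N) (x : Fin N → Fin D → ℝ)
    (l : Fin N → ℝ) (w : Fin D → ℝ) (b : ℝ)
    (hlt : (Finset.univ.filter fun n => (∑ i, w i * x n i) + b = 0).card < D) :
    ∃ (w' : Fin D → ℝ) (b' : ℝ), w' ≠ 0 ∧ loss01 x l w' b' ≤ loss01 x l w b ∧
      (Finset.univ.filter fun n => (∑ i, w i * x n i) + b = 0).card <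
        (Finset.univ.filter fun n => (∑ i, w' i * x n i) + b' = 0).card := by
  set Z := Finset.univ.filter fun n => (∑ i, w i * x n i) + b = 0 with hZ
  have memZ : ∀ n, n ∈ Z ↔ (∑ i, w i * x n i) + b = 0 := fun n => by simp [hZ]
  obtain ⟨n, hn⟩ : ∃ n, n ∉ Z := by
    by_contra! h
    have := Finset.card_eq_of_equiv_fin (Equiv.subtypeUnivEquiv h)
    omega
  obtain ⟨v, c, hvc, hv⟩ := exists_affine_functional_vanishing_on x (insert n Z)
    ((Finset.card_insert_le _ _).trans hlt)
  obtain ⟨m, hm, hmin⟩ := Zᶜ.exists_min_image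
    (fun m => ((∑ i, v i * x m i) + c) / ((∑ i, w i * x m i) + b))
    ⟨n, Finset.mem_compl.mpr hn⟩
  set r := ((∑ i, v i * x m i) + c) / ((∑ i, w i * x m i) + b) with hr
  rw [Finset.mem_compl, memZ] at hm
  have eval : ∀ j, (∑ i, (v - r • w) i * x j i) + (c - r * b) =
      ((∑ i, v i * x j i) + c) - r * ((∑ i, w i * x j i) + b) := fun j => by
    simp only [Pi.sub_apply, Pi.smul_apply, smul_eq_mul, sub_mul, Finset.sum_sub_distrib,
      mul_add, Finset.mul_sum, mul_assoc]
    ring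
  have zero_m : (∑ i, (v - r • w) i * x m i) + (c - r * b) = 0 := by
    rw [eval, hr, div_mul_cancel₀ _ hm, sub_self]
  have zero_Z : ∀ j ∈ Z, (∑ i, (v - r • w) i * x j i) + (c - r * b) = 0 := fun j hj => by
    rw [eval, hv j (Finset.mem_insert_of_mem hj), (memZ j).mp hj]
    simp
  refine ⟨v - r • w, c - r * b, ?_, ?_, ?_⟩
  · intro h0
    have hb : c - r * b = 0 := by
      rw [h0] at zero_m
      simpa only [Pi.zero_apply, zero_mul, Finset.sum_const_zero, zero_add] using zero_m
    have hn0 := eval n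
    rw [hv n (Finset.mem_insert_self _ _), h0, hb] at hn0
    have hr0 : r = 0 := by
      rw [memZ] at hn
      simpa [hn] using hn0
    rw [hr0] at h0 hb
    exact hvc.elim (fun h => h (by simpa using h0)) (fun h => h (by simpa using hb))
  · refine Set.ncard_le_ncard ?_ (Set.toFinite _)
    rintro j ⟨hj, hjl⟩
    have hjZ : j ∉ Z := fun h => hj (zero_Z j h)
    have hwj : (∑ i, w i * x j i) + b ≠ 0 := fun h => hjZ ((memZ j).mpr h)
    refine ⟨hwj, fun hs => hjl ?_⟩
    have hfac : (∑ i, (v - r • w) i * x j i) + (c - r * b) =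
        (((∑ i, v i * x j i) + c) / ((∑ i, w i * x j i) + b) - r) *
          ((∑ i, w i * x j i) + b) := by
      rw [eval, sub_mul, div_mul_cancel₀ _ hwj]
    have hpos : 0 < ((∑ i, v i * x j i) + c) / ((∑ i, w i * x j i) + b) - r := by
      refine lt_of_le_of_ne (sub_nonneg.mpr (hmin j (Finset.mem_compl.mpr hjZ))) ?_
      intro h
      rw [hfac, ← h, zero_mul] at hj
      exact hj rfl
    rw [← hs, hfac]
    rcases lt_or_gt_of_ne hwj with h | h
    · rw [Real.sign_of_neg h, Real.sign_of_neg (mul_neg_of_pos_of_neg hpos h)]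
    · rw [Real.sign_of_pos h, Real.sign_of_pos (mul_pos hpos h)]
  · refine Finset.card_lt_card (Finset.ssubset_iff_subset_ne.mpr ⟨fun j hj => ?_, fun h => ?_⟩)
    · simpa using zero_Z j hj
    · have : m ∈ Z := by
        rw [h]
        simpa using zero_m
      exact hm ((memZ m).mp this)

/-- The global minimum of the 0-1 loss is attained by an (appropriately oriented)
hyperplane passing through `D` of the `N` data points, provided the points are in
general position. -/
theorem exists_optimal_hyperplane_through_D_points
    (N D : ℕ) (hN : 0 < N) (hD : 0 < D) (hND : D ≤ N)
    (x : Fin N → Fin D → ℝ)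
    (hgen : ∀ s : Finset (Fin N), s.card ≤ D + 1 →
      AffineIndependent ℝ (fun n : s => x n))
    (l : Fin N → ℝ) (hl : ∀ n, l n = 1 ∨ l n = -1) :
    ∃ (w : Fin D → ℝ) (b : ℝ) (S : Finset (Fin N)),
      w ≠ 0 ∧ S.card = D ∧
      (∀ n ∈ S, (∑ i, w i * x n i) + b = 0) ∧
      (∀ (w' : Fin D → ℝ) (b' : ℝ), w' ≠ 0 →
        loss01 x l w b ≤ loss01 x l w' b') := by
  obtain ⟨p, hp, hpmin⟩ : ∃ p : (Fin D → ℝ) × ℝ, p.1 ≠ 0 ∧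
      ∀ q : (Fin D → ℝ) × ℝ, q.1 ≠ 0 → loss01 x l p.1 p.2 ≤ loss01 x l q.1 q.2 := by
    obtain ⟨p, hp, hmin⟩ := (measure fun p : (Fin D → ℝ) × ℝ => loss01 x l p.1 p.2).wf.has_min
      {p | p.1 ≠ 0} ⟨(fun _ => 1, 0), fun h => one_ne_zero (congrFun h ⟨0, hD⟩)⟩
    exact ⟨p, hp, fun q hq => not_lt.mp (hmin q hq)⟩
  have key : ∀ k ≤ D, ∃ (w : Fin D → ℝ) (b : ℝ), w ≠ 0 ∧
      loss01 x l w b ≤ loss01 x l p.1 p.2 ∧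
      k ≤ (Finset.univ.filter fun n => (∑ i, w i * x n i) + b = 0).card := by
    intro k
    induction k with
    | zero => exact fun _ => ⟨p.1, p.2, hp, le_rfl, Nat.zero_le _⟩
    | succ k ih =>
      intro hk
      obtain ⟨w, b, hw, hle, hcard⟩ := ih (by omega)
      by_cases h : k + 1 ≤ (Finset.univ.filter fun n => (∑ i, w i * x n i) + b = 0).card
      · exact ⟨w, b, hw, hle, h⟩
      · obtain ⟨w', b', hw', hle', hcard'⟩ :=
          exists_loss01_le_card_zeros_lt hND x l w b (by omega)
        exact ⟨w', b', hw', hle'.trans hle, by omega⟩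
  obtain ⟨w, b, hw, hle, hcard⟩ := key D le_rfl
  obtain ⟨S, hS, hSD⟩ := Finset.exists_subset_card_eq hcard
  exact ⟨w, b, S, hw, hSD, fun n hn => (Finset.mem_filter.mp (hS hn)).2,
    fun w' b' hw' => hle.trans (hpmin (w', b') hw')⟩
end

section
/- Unbounded cells of a simple arrangement come in complementary pairs: let h_1, …, h_N be affine hyperplanes in ℝ^D given by h_n = {x : ⟨a_n, x⟩ = c_n} with a_n ≠ 0, forming a simple arrangement (in general position), and let σ ∈ {−1, +1}^N be a nowhere-zero sign vector. If the set R_σ = {x ∈ ℝ^D : sign(⟨a_n, x⟩ − c_n) = σ_n for all n} is nonempty and unbounded, then R_{−σ} = {x ∈ ℝ^D : sign(⟨a_n, x⟩ − c_n) = −σ_n for all n} is also nonempty. -/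
/-- The arrangement of affine hyperplanes `{x | ⟨a n, x⟩ = c n}` in `ℝ^D` is
*simple* (in general position): any `k ≤ D` of the hyperplanes intersect in an
affine flat of dimension `D − k`, and any `k > D` of them have empty
intersection. -/
def IsSimpleArrangement {N D : ℕ} (a : Fin N → Fin D → ℝ) (c : Fin N → ℝ) : Prop :=
  ∀ s : Finset (Fin N),
    (s.card ≤ D → ∃ (x₀ : Fin D → ℝ) (V : Submodule ℝ (Fin D → ℝ)),
      Module.finrank ℝ V = D - s.card ∧
      {x : Fin D → ℝ | ∀ n ∈ s, ∑ i, a n i * x i = c n} = {x | x - x₀ ∈ V}) ∧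
    (D < s.card → {x : Fin D → ℝ | ∀ n ∈ s, ∑ i, a n i * x i = c n} = ∅)

open Filter Topology

theorem Real.sign_eq_iff_mul_pos {s y : ℝ} (hs : s = 1 ∨ s = -1) :
    Real.sign y = s ↔ 0 < s * y := by
  rcases lt_trichotomy y 0 with h | h | h
  · rw [Real.sign_of_neg h]
    rcases hs with rfl | rfl <;> norm_num <;> linarith
  · subst h
    rcases hs with rfl | rfl <;> norm_num
  · rw [Real.sign_of_pos h]
    rcases hs with rfl | rfl <;> norm_num <;> linarith

/-- An unbounded intersection of finitely many open half-spaces has a nonzero recession direction. -/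
theorem exists_recession_direction {N D : ℕ} (b : Fin N → Fin D → ℝ) (d : Fin N → ℝ)
    (hubd : ¬ Bornology.IsBounded {x : Fin D → ℝ | ∀ n, d n < b n ⬝ᵥ x}) :
    ∃ v : Fin D → ℝ, v ≠ 0 ∧ ∀ n, 0 ≤ b n ⬝ᵥ v := by
  have hx : ∀ k : ℕ, ∃ x : Fin D → ℝ, (∀ n, d n < b n ⬝ᵥ x) ∧ (k : ℝ) + 1 < ‖x‖ := by
    intro k
    by_contra! h
    exact hubd (isBounded_iff_forall_norm_le.2 ⟨(k : ℝ) + 1, fun x hx => h x hx⟩)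
  choose x hxb hxn using hx
  have hpos : ∀ k, 0 < ‖x k‖ := fun k => lt_trans (by positivity) (hxn k)
  have hnorm : Tendsto (fun k => ‖x k‖) atTop atTop :=
    tendsto_atTop_mono (fun k => by linarith [hxn k]) tendsto_natCast_atTop_atTop
  have hmem : ∀ k, ‖x k‖⁻¹ • x k ∈ Metric.sphere (0 : Fin D → ℝ) 1 := by
    intro k
    rw [mem_sphere_zero_iff_norm, norm_smul, norm_inv, norm_norm, inv_mul_cancel₀ (hpos k).ne']
  obtain ⟨v, hv, φ, hφ, hlim⟩ := (isCompact_sphere (0 : Fin D → ℝ) 1).tendsto_subseq hmem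
  refine ⟨v, ne_zero_of_mem_unit_sphere ⟨v, hv⟩, fun n => ?_⟩
  have hcont : Continuous fun y : Fin D → ℝ => b n ⬝ᵥ y := by
    unfold dotProduct
    fun_prop
  have hleft : Tendsto (fun k => ‖x (φ k)‖⁻¹ * d n) atTop (𝓝 0) := by
    simpa using (hnorm.comp hφ.tendsto_atTop).inv_tendsto_atTop.mul_const (d n)
  refine le_of_tendsto_of_tendsto' hleft ((hcont.tendsto v).comp hlim) fun k => ?_
  simp only [Function.comp_apply, dotProduct_smul, smul_eq_mul]
  exact mul_le_mul_of_nonneg_left (hxb _ n).le (inv_nonneg.2 (norm_nonneg _))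

theorem IsSimpleArrangement.exists_direction {N D : ℕ} {a : Fin N → Fin D → ℝ} {c : Fin N → ℝ}
    (h : IsSimpleArrangement a c) {s : Finset (Fin N)} (hs : s.card ≤ D) :
    ∃ V : Submodule ℝ (Fin D → ℝ), Module.finrank ℝ V = D - s.card ∧
      ∀ x, x ∈ V ↔ ∀ n ∈ s, a n ⬝ᵥ x = 0 := by
  obtain ⟨x₀, V, hV, heq⟩ := (h s).1 hs
  have key : ∀ x, (∀ n ∈ s, a n ⬝ᵥ x = c n) ↔ x - x₀ ∈ V := fun x => Set.ext_iff.1 heq x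
  have h₀ : ∀ n ∈ s, a n ⬝ᵥ x₀ = c n := (key x₀).2 (by simp)
  refine ⟨V, hV, fun x => ?_⟩
  have hx := key (x₀ + x)
  rw [add_sub_cancel_left] at hx
  rw [← hx]
  refine forall₂_congr fun n hn => ?_
  rw [dotProduct_add, h₀ n hn, add_eq_left]

/-- The normals of at most `D` hyperplanes of a simple arrangement take arbitrary values. -/
theorem IsSimpleArrangement.exists_dotProduct_eq {N D : ℕ} {a : Fin N → Fin D → ℝ}
    {c : Fin N → ℝ} (h : IsSimpleArrangement a c) {s : Finset (Fin N)} (hs : s.card ≤ D)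
    (f : Fin N → ℝ) : ∃ u, ∀ n ∈ s, a n ⬝ᵥ u = f n := by
  obtain ⟨V, hV, hmem⟩ := h.exists_direction hs
  let φ : (Fin D → ℝ) →ₗ[ℝ] (s → ℝ) := (Matrix.of fun n : s => a n).mulVecLin
  have hker : LinearMap.ker φ = V := by
    ext x
    rw [hmem, LinearMap.mem_ker, funext_iff]
    exact Subtype.forall
  have hrank := φ.finrank_range_add_finrank_ker
  rw [hker, hV, Module.finrank_fin_fun] at hrank
  have htop : LinearMap.range φ = ⊤ := by
    apply Submodule.eq_top_of_finrank_eq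
    rw [Module.finrank_fintype_fun_eq_card, Fintype.card_coe]
    omega
  obtain ⟨u, hu⟩ := LinearMap.range_eq_top.1 htop fun n => f n
  exact ⟨u, fun n hn => congrFun hu ⟨n, hn⟩⟩

theorem IsSimpleArrangement.card_lt_of_dotProduct_eq_zero {N D : ℕ} {a : Fin N → Fin D → ℝ}
    {c : Fin N → ℝ} (h : IsSimpleArrangement a c) {s : Finset (Fin N)} {v : Fin D → ℝ}
    (hv : v ≠ 0) (hs : ∀ n ∈ s, a n ⬝ᵥ v = 0) : s.card < D := by
  by_contra! hD
  obtain ⟨t, hts, ht⟩ := Finset.exists_subset_card_eq hD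
  obtain ⟨V, hV, hmem⟩ := h.exists_direction ht.le
  rw [ht, Nat.sub_self, Submodule.finrank_eq_zero] at hV
  have hvV := (hmem v).2 fun n hn => hs n (hts hn)
  rw [hV, Submodule.mem_bot] at hvV
  exact hv hvV

/-- Unbounded cells of a simple arrangement come in complementary pairs: if the
cell of a nowhere-zero sign vector `σ` is nonempty and unbounded, then the cell
of `−σ` is also nonempty. -/
theorem unbounded_cell_has_complement (N D : ℕ)
    (a : Fin N → Fin D → ℝ) (c : Fin N → ℝ)
    (ha : ∀ n, a n ≠ 0) (hsimple : IsSimpleArrangement a c)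
    (σ : Fin N → ℝ) (hσ : ∀ n, σ n = 1 ∨ σ n = -1)
    (hne : {x : Fin D → ℝ | ∀ n, Real.sign ((∑ i, a n i * x i) - c n) = σ n}.Nonempty)
    (hubd : ¬ Bornology.IsBounded
      {x : Fin D → ℝ | ∀ n, Real.sign ((∑ i, a n i * x i) - c n) = σ n}) :
    {x : Fin D → ℝ | ∀ n, Real.sign ((∑ i, a n i * x i) - c n) = -σ n}.Nonempty := by
  have hσ' : ∀ n, -σ n = 1 ∨ -σ n = -1 := fun n => by
    rcases hσ n with h | h <;> simp [h]
  have hcell : {x : Fin D → ℝ | ∀ n, Real.sign ((∑ i, a n i * x i) - c n) = σ n} =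
      {x | ∀ n, σ n * c n < (σ n • a n) ⬝ᵥ x} := by
    ext x
    refine forall_congr' fun n => ?_
    rw [Real.sign_eq_iff_mul_pos (hσ n), smul_dotProduct, smul_eq_mul, mul_sub, sub_pos]
    rfl
  rw [hcell] at hubd
  obtain ⟨v, hv, hvn⟩ := exists_recession_direction _ _ hubd
  simp only [smul_dotProduct, smul_eq_mul] at hvn
  have hσ0 : ∀ n, σ n ≠ 0 := fun n => by rcases hσ n with h | h <;> simp [h]
  let s : Finset (Fin N) := {n | a n ⬝ᵥ v = 0}
  have hs : s.card ≤ D :=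
    (hsimple.card_lt_of_dotProduct_eq_zero hv fun n hn => by simpa [s] using hn).le
  obtain ⟨u, hu⟩ := hsimple.exists_dotProduct_eq hs σ
  have hε : ∀ᶠ ε : ℝ in 𝓝[>] 0, ∀ n, 0 < σ n * (a n ⬝ᵥ (v + ε • u)) := by
    refine eventually_all.2 fun n => ?_
    simp only [dotProduct_add, dotProduct_smul, smul_eq_mul]
    by_cases hn : a n ⬝ᵥ v = 0
    · filter_upwards [self_mem_nhdsWithin] with ε hε
      rw [hn, hu n (by simpa [s] using hn), zero_add, mul_left_comm]
      exact mul_pos hε (mul_self_pos.2 (hσ0 n))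
    · have hpos : 0 < σ n * (a n ⬝ᵥ v) := (hvn n).lt_of_ne' (mul_ne_zero (hσ0 n) hn)
      have hcont : Continuous fun ε : ℝ => σ n * (a n ⬝ᵥ v + ε * (a n ⬝ᵥ u)) := by fun_prop
      refine (hcont.tendsto 0).mono_left nhdsWithin_le_nhds |>.eventually_const_lt ?_
      simpa using hpos
  obtain ⟨ε, hw⟩ := hε.exists
  have ht : ∀ᶠ t : ℝ in atTop, ∀ n, -(σ n * c n) < t * (σ n * (a n ⬝ᵥ (v + ε • u))) :=
    eventually_all.2 fun n =>
      (tendsto_id.atTop_mul_const (hw n)).eventually_gt_atTop _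
  obtain ⟨t, ht⟩ := ht.exists
  refine ⟨-(t • (v + ε • u)), fun n => (Real.sign_eq_iff_mul_pos (hσ' n)).2 ?_⟩
  change 0 < -σ n * (a n ⬝ᵥ (-(t • (v + ε • u))) - c n)
  rw [dotProduct_neg, dotProduct_smul, smul_eq_mul]
  linarith [ht n]
end

section
/- Cover's function counting theorem: let N ≥ 1 and D ≥ 0, and let x_1, …, x_N ∈ ℝ^{D+1} be vectors such that every subset of at most D+1 of them is linearly independent. Then the number of sign vectors σ ∈ {−1, +1}^N for which there exists w ∈ ℝ^{D+1} with σ_n · ⟨w, x_n⟩ > 0 for all n (i.e., the number of homogeneously linearly separable dichotomies of the point set) equals C(N, D+1) = 2 · Σ_{d=0}^{D} C(N−1, d). -/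
/-- The sign vectors realized strictly by a family of linear functionals. -/
def realizableSigns {V : Type*} [AddCommGroup V] [Module ℝ V] {N : ℕ}
    (f : Fin N → Module.Dual ℝ V) : Set (Fin N → ℝ) :=
  {σ | (∀ n, σ n = 1 ∨ σ n = -1) ∧ ∃ w : V, ∀ n, 0 < σ n * f n w}

/-- A family of functionals is in general position if every subfamily whose size is at most the
dimension of the space is linearly independent. -/
def GeneralPosition {V : Type*} [AddCommGroup V] [Module ℝ V] {N : ℕ}
    (f : Fin N → Module.Dual ℝ V) : Prop :=
  ∀ s : Finset (Fin N), s.card ≤ Module.finrank ℝ V → LinearIndepOn ℝ f (s : Set (Fin N))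

theorem finite_signs (N : ℕ) : {σ : Fin N → ℝ | ∀ n, σ n = 1 ∨ σ n = -1}.Finite := by
  have h := Set.Finite.pi' (fun _ : Fin N => (Set.toFinite ({1, -1} : Set ℝ)))
  simpa using h

section

variable {V : Type*} [AddCommGroup V] [Module ℝ V] {N : ℕ}

theorem exists_pos_forall_sign_mul_add_smul_pos (f : Fin N → Module.Dual ℝ V) (σ : Fin N → ℝ)
    (w v : V) (hw : ∀ n, 0 < σ n * f n w) :
    ∃ ε : ℝ, 0 < ε ∧ ∀ n, 0 < σ n * f n (w + ε • v) := by
  have h : ∀ᶠ ε : ℝ in nhdsWithin 0 (Set.Ioi 0), ∀ n, 0 < σ n * f n (w + ε • v) := by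
    refine Filter.Eventually.filter_mono nhdsWithin_le_nhds (Filter.eventually_all.2 fun n => ?_)
    have hc : Continuous fun ε : ℝ => σ n * f n (w + ε • v) := by
      simp only [map_add, map_smul, smul_eq_mul]
      fun_prop
    exact hc.continuousAt.eventually (lt_mem_nhds (by simpa using hw n))
  obtain ⟨ε, h₁, h₂⟩ := (h.and self_mem_nhdsWithin).exists
  exact ⟨ε, h₂, h₁⟩

theorem ncard_realizableSigns_succ (f : Fin (N + 1) → Module.Dual ℝ V) (hf : f 0 ≠ 0) :
    (realizableSigns f).ncard = (realizableSigns fun n : Fin N => f n.succ).ncard +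
      (realizableSigns fun n : Fin N =>
        (f n.succ).comp (LinearMap.ker (f 0)).subtype).ncard := by
  obtain ⟨v, hv⟩ : ∃ v, f 0 v = 1 := LinearMap.surjective hf 1
  let A : ℝ → Set (Fin N → ℝ) := fun s =>
    {σ | (∀ n, σ n = 1 ∨ σ n = -1) ∧ ∃ w : V, 0 < s * f 0 w ∧ ∀ n : Fin N, 0 < σ n * f n.succ w}
  have hfin : ∀ s, (A s).Finite := fun s => (finite_signs N).subset fun σ hσ => hσ.1
  have hperturb : ∀ (s : ℝ) (σ : Fin N → ℝ) (w : V), s * s = 1 → f 0 w = 0 →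
      (∀ n : Fin N, 0 < σ n * f n.succ w) →
      ∃ w : V, 0 < s * f 0 w ∧ ∀ n : Fin N, 0 < σ n * f n.succ w := by
    intro s σ w hs h0 hw
    obtain ⟨ε, hε, h⟩ :=
      exists_pos_forall_sign_mul_add_smul_pos (fun n : Fin N => f n.succ) σ w (s • v) hw
    refine ⟨w + ε • s • v, ?_, h⟩
    have : s * f 0 (w + ε • s • v) = ε * (s * s) := by
      simp [h0, hv]; ring
    rw [this, hs]
    simpa using hε
  have hsplit : realizableSigns f = Set.image (Fin.cons (α := fun _ => ℝ) 1) (A 1) ∪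
      Set.image (Fin.cons (α := fun _ => ℝ) (-1)) (A (-1)) := by
    ext σ
    constructor
    · rintro ⟨hσ, w, hw⟩
      rcases hσ 0 with h | h
      · refine Or.inl ⟨Fin.tail σ, ⟨fun n => hσ n.succ, w, h ▸ hw 0, fun n => hw n.succ⟩, ?_⟩
        rw [← h, Fin.cons_self_tail]
      · refine Or.inr ⟨Fin.tail σ, ⟨fun n => hσ n.succ, w, h ▸ hw 0, fun n => hw n.succ⟩, ?_⟩
        rw [← h, Fin.cons_self_tail]
    · rintro (⟨τ, ⟨hτ, w, h0, hw⟩, rfl⟩ | ⟨τ, ⟨hτ, w, h0, hw⟩, rfl⟩)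
      · exact ⟨Fin.cases (by simp) (by simpa using hτ), w,
          Fin.cases (by simpa using h0) (by simpa using hw)⟩
      · exact ⟨Fin.cases (by simp) (by simpa using hτ), w,
          Fin.cases (by simpa using h0) (by simpa using hw)⟩
  have hdisj : Disjoint (Set.image (Fin.cons (α := fun _ => ℝ) 1) (A 1))
      (Set.image (Fin.cons (α := fun _ => ℝ) (-1)) (A (-1))) := by
    rw [Set.disjoint_left]
    rintro _ ⟨τ, -, rfl⟩ ⟨ρ, -, h⟩
    have := congrFun h 0
    simp only [Fin.cons_zero] at this
    norm_num at this
  have hunion : A 1 ∪ A (-1) = realizableSigns fun n : Fin N => f n.succ := by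
    ext σ
    constructor
    · rintro (⟨hσ, w, -, hw⟩ | ⟨hσ, w, -, hw⟩) <;> exact ⟨hσ, w, hw⟩
    · rintro ⟨hσ, w, hw⟩
      rcases lt_trichotomy (f 0 w) 0 with h | h | h
      · exact Or.inr ⟨hσ, w, by linarith, hw⟩
      · exact Or.inl ⟨hσ, hperturb 1 σ w (by norm_num) h hw⟩
      · exact Or.inl ⟨hσ, w, by linarith, hw⟩
  have hinter : A 1 ∩ A (-1) = realizableSigns fun n : Fin N =>
      (f n.succ).comp (LinearMap.ker (f 0)).subtype := by
    ext σ
    constructor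
    · rintro ⟨⟨hσ, w₁, h₁, hw₁⟩, -, w₂, h₂, hw₂⟩
      refine ⟨hσ, ⟨(-f 0 w₂) • w₁ + f 0 w₁ • w₂, ?_⟩, fun n => ?_⟩
      · simp only [LinearMap.mem_ker, map_add, map_smul, smul_eq_mul]
        ring
      · have e₁ := mul_pos (show 0 < -f 0 w₂ by linarith) (hw₁ n)
        have e₂ := mul_pos (show 0 < f 0 w₁ by linarith) (hw₂ n)
        simp only [LinearMap.comp_apply, Submodule.subtype_apply, map_add, map_smul, smul_eq_mul]
        linarith
    · rintro ⟨hσ, ⟨w, h0⟩, hw⟩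
      exact ⟨⟨hσ, hperturb 1 σ w (by norm_num) h0 hw⟩,
        ⟨hσ, hperturb (-1) σ w (by norm_num) h0 hw⟩⟩
  rw [hsplit, Set.ncard_union_eq hdisj ((hfin _).image _) ((hfin _).image _),
    Set.ncard_image_of_injective _ (Fin.cons_right_injective _),
    Set.ncard_image_of_injective _ (Fin.cons_right_injective _),
    ← Set.ncard_union_add_ncard_inter _ _ (hfin _) (hfin _), hunion, hinter]

theorem GeneralPosition.succ {f : Fin (N + 1) → Module.Dual ℝ V} (hf : GeneralPosition f) :
    GeneralPosition fun n : Fin N => f n.succ := by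
  intro s hs
  have h := hf (s.map (Fin.succEmb N)) (by simpa using hs)
  rw [Finset.coe_map] at h
  exact h.comp_of_image (Fin.succ_injective N).injOn

theorem GeneralPosition.restrict_ker {f : Fin (N + 1) → Module.Dual ℝ V}
    (hf : GeneralPosition f) (h0 : f 0 ≠ 0)
    (hdim : Module.finrank ℝ (LinearMap.ker (f 0)) + 1 = Module.finrank ℝ V) :
    GeneralPosition fun n : Fin N => (f n.succ).comp (LinearMap.ker (f 0)).subtype := by
  obtain ⟨v, hv⟩ : ∃ v, f 0 v = 1 := LinearMap.surjective h0 1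
  intro s hs
  rw [linearIndepOn_finset_iff]
  intro c hc
  have hmem : (0 : Fin (N + 1)) ∉ s.map (Fin.succEmb N) := by simp
  have h := hf (Finset.cons 0 (s.map (Fin.succEmb N)) hmem) (by simp; omega)
  rw [linearIndepOn_finset_iff] at h
  have key := h (Fin.cons (α := fun _ => ℝ) (-∑ i ∈ s, c i * f i.succ v) c) (by
    ext w
    have hw := LinearMap.congr_fun hc ⟨w - f 0 w • v, by simp [hv]⟩
    simp only [LinearMap.sum_apply, LinearMap.smul_apply, LinearMap.comp_apply,
      Submodule.subtype_apply, map_sub, map_smul, smul_eq_mul, LinearMap.zero_apply, mul_sub,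
      Finset.sum_sub_distrib] at hw
    simp only [Finset.sum_cons, Finset.sum_map, Fin.coe_succEmb, Fin.cons_zero, Fin.cons_succ,
      LinearMap.add_apply, LinearMap.sum_apply, LinearMap.smul_apply, smul_eq_mul,
      LinearMap.zero_apply]
    rw [← hw, neg_mul, Finset.sum_mul, neg_add_eq_sub]
    congr 1
    exact Finset.sum_congr rfl fun i _ => by ring)
  intro i hi
  simpa using key i.succ (by simp [hi])

end

theorem two_mul_sum_choose_succ (N d : ℕ) :
    2 * ∑ k ∈ Finset.range (d + 1), (N + 1).choose k =
      2 * ∑ k ∈ Finset.range (d + 1), N.choose k + 2 * ∑ k ∈ Finset.range d, N.choose k := by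
  rw [Finset.sum_range_succ', Finset.sum_range_succ' (fun k => N.choose k)]
  simp only [Nat.choose_succ_succ', Finset.sum_add_distrib, Nat.choose_zero_right]
  ring

theorem ncard_realizableSigns_zero {V : Type*} [AddCommGroup V] [Module ℝ V]
    (f : Fin 0 → Module.Dual ℝ V) : (realizableSigns f).ncard = 1 := by
  have : realizableSigns f = Set.univ :=
    Set.eq_univ_of_forall fun σ => ⟨fun n => n.elim0, 0, fun n => n.elim0⟩
  rw [this, Set.ncard_univ, Nat.card_unique]

theorem ncard_realizableSigns_of_generalPosition (N : ℕ) :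
    ∀ {V : Type*} [AddCommGroup V] [Module ℝ V] [FiniteDimensional ℝ V]
      (f : Fin (N + 1) → Module.Dual ℝ V), GeneralPosition f →
      (realizableSigns f).ncard = 2 * ∑ k ∈ Finset.range (Module.finrank ℝ V), N.choose k := by
  induction N with
  | zero =>
    intro V _ _ _ f hf
    rcases hd : Module.finrank ℝ V with _ | d
    · have := Module.finrank_zero_iff.1 hd
      have : realizableSigns f = ∅ := Set.eq_empty_of_forall_notMem fun σ ⟨_, w, hw⟩ => by
        simpa [Subsingleton.elim w 0] using hw 0
      simp [this]
    · have h0 : f 0 ≠ 0 := (hf {0} (by simp [hd])).ne_zero (by simp)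
      rw [ncard_realizableSigns_succ f h0, ncard_realizableSigns_zero, ncard_realizableSigns_zero,
        Finset.sum_range_succ']
      simp
  | succ N ih =>
    intro V _ _ _ f hf
    rcases hd : Module.finrank ℝ V with _ | d
    · have := Module.finrank_zero_iff.1 hd
      have : realizableSigns f = ∅ := Set.eq_empty_of_forall_notMem fun σ ⟨_, w, hw⟩ => by
        simpa [Subsingleton.elim w 0] using hw 0
      simp [this]
    · have h0 : f 0 ≠ 0 := (hf {0} (by simp [hd])).ne_zero (by simp)
      have hdim := Module.Dual.finrank_ker_add_one_of_ne_zero h0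
      rw [ncard_realizableSigns_succ f h0, ih _ hf.succ, ih _ (hf.restrict_ker h0 hdim),
        two_mul_sum_choose_succ, hd, show Module.finrank ℝ (LinearMap.ker (f 0)) = d by omega]

/-- Cover's function counting theorem: for `N ≥ 1` vectors in `ℝ^{D+1}` in
general position (every subset of at most `D+1` of them is linearly
independent), the number of homogeneously linearly separable dichotomies
`σ ∈ {−1,+1}^N` (those realizable as `σ n * ⟨w, x n⟩ > 0` for all `n`, for some
`w ∈ ℝ^{D+1}`) equals `C(N, D+1) = 2 · Σ_{d=0}^{D} C(N−1, d)`. -/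
theorem cover_function_counting (N D : ℕ) (hN : 1 ≤ N)
    (x : Fin N → Fin (D + 1) → ℝ)
    (hgen : ∀ s : Finset (Fin N), s.card ≤ D + 1 →
      LinearIndependent ℝ (fun n : s => x n)) :
    {σ : Fin N → ℝ | (∀ n, σ n = 1 ∨ σ n = -1) ∧
        ∃ w : Fin (D + 1) → ℝ, ∀ n, σ n * ∑ i, w i * x n i > 0}.ncard =
      2 * ∑ d ∈ Finset.range (D + 1), Nat.choose (N - 1) d := by
  obtain ⟨N, rfl⟩ : ∃ M, N = M + 1 := ⟨N - 1, by omega⟩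
  let f : Fin (N + 1) → Module.Dual ℝ (Fin (D + 1) → ℝ) := fun n =>
    dotProductEquiv ℝ (Fin (D + 1)) (x n)
  have hf : GeneralPosition f := fun s hs =>
    (hgen s (by simpa using hs)).map' (dotProductEquiv ℝ (Fin (D + 1))).toLinearMap
      (LinearEquiv.ker _)
  have h := ncard_realizableSigns_of_generalPosition N f hf
  simpa [realizableSigns, f, dotProduct, mul_comm] using h
end

section
/- Region count of a simple arrangement: let h_1, …, h_N be affine hyperplanes in ℝ^D (N ≥ 0, D ≥ 1) forming a simple arrangement (in general position). Then the number of connected components of ℝ^D ∖ (h_1 ∪ ⋯ ∪ h_N) equals Σ_{d=0}^{D} C(N, d). -/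
open Finset in
/-- A family of subsets of a finite type has at least as many members as it has strongly shattered
sets, a set `s` being strongly shattered when some fixed trace outside `s` can be completed
arbitrarily inside `s`. -/
theorem Finset.card_le_card_of_strongly_shattered {α : Type*} [Fintype α] [DecidableEq α]
    (𝒜 ℬ : Finset (Finset α)) (h : ∀ s ∈ ℬ, ∃ t, ∀ u, sᶜ ∩ u = sᶜ ∩ t → u ∈ 𝒜) :
    #ℬ ≤ #𝒜 := by
  have hdisj : Disjoint (ℬ.image compl) 𝒜ᶜ.shatterer := by
    rw [Finset.disjoint_left]
    intro r hr hr'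
    obtain ⟨s, hs, rfl⟩ := Finset.mem_image.1 hr
    obtain ⟨t, ht⟩ := h s hs
    obtain ⟨u, hu, hut⟩ := (mem_shatterer.1 hr') (inter_subset_left (s₁ := sᶜ) (s₂ := t))
    exact (mem_compl.1 hu) (ht u hut)
  have hle := card_le_univ (ℬ.image compl ∪ 𝒜ᶜ.shatterer)
  rw [card_union_of_disjoint hdisj, card_image_of_injective _ compl_injective] at hle
  have := card_le_card_shatterer 𝒜ᶜ
  have := card_add_card_compl 𝒜
  omega

theorem Finset.card_filter_card_le (α : Type*) [Fintype α] (D : ℕ) :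
    (Finset.univ.filter fun s : Finset α => s.card ≤ D).card =
      ∑ d ∈ Finset.range (D + 1), (Fintype.card α).choose d := by
  classical
  rw [Finset.card_eq_sum_card_fiberwise (f := Finset.card) (t := Finset.range (D + 1))]
  · refine Finset.sum_congr rfl fun d hd => ?_
    rw [← Finset.card_univ, ← Finset.card_powersetCard]
    congr 1
    ext s
    simp only [Finset.mem_range] at hd
    simp only [Finset.mem_filter, Finset.mem_univ, true_and, Finset.mem_powersetCard,
      Finset.subset_univ]
    omega
  · intro s hs
    simp at hs ⊢
    omega

theorem Set.ncard_image_eq_of_eq_iff {α β γ : Type*} {f : α → β} {g : α → γ} {U : Set α}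
    (h : ∀ x ∈ U, ∀ y ∈ U, f x = f y ↔ g x = g y) : (f '' U).ncard = (g '' U).ncard := by
  have hex : ∀ b ∈ f '' U, ∃ x ∈ U, f x = b := fun b hb => hb
  choose p hp hfp using hex
  refine Set.ncard_congr (fun b hb => g (p b hb)) (fun b hb => ⟨_, hp b hb, rfl⟩) ?_ ?_
  · intro b b' hb hb' hgg
    rw [← hfp b hb, ← hfp b' hb']
    exact (h _ (hp _ _) _ (hp _ _)).2 hgg
  · rintro _ ⟨x, hx, rfl⟩
    exact ⟨f x, ⟨x, hx, rfl⟩, (h _ (hp _ _) _ hx).1 (hfp _ _)⟩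

namespace HyperplaneArrangement

variable {N D : ℕ} (a : Fin N → Fin D → ℝ) (c : Fin N → ℝ)

/-- The complement of the hyperplanes. -/
def compl : Set (Fin D → ℝ) := {y | ∀ n, ∑ i, a n i * y i ≠ c n}

open Classical in
/-- The hyperplanes having `x` strictly on their positive side. -/
noncomputable def pattern (x : Fin D → ℝ) : Finset (Fin N) :=
  Finset.univ.filter fun n => c n < ∑ i, a n i * x i

variable {a c}

theorem mem_pattern {x : Fin D → ℝ} {n : Fin N} :
    n ∈ pattern a c x ↔ c n < ∑ i, a n i * x i := by
  simp [pattern]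

theorem sum_mul_add_smul (b x v : Fin D → ℝ) (t : ℝ) :
    ∑ i, b i * (x + t • v) i = ∑ i, b i * x i + t * ∑ i, b i * v i := by
  rw [Finset.mul_sum, ← Finset.sum_add_distrib]
  exact Finset.sum_congr rfl fun i _ => by simp; ring

theorem connectedComponentIn_eq_iff {x y : Fin D → ℝ} (hx : x ∈ compl a c) (hy : y ∈ compl a c) :
    connectedComponentIn (compl a c) x = connectedComponentIn (compl a c) y ↔
      pattern a c x = pattern a c y := by
  constructor
  · intro h
    have key : ∀ {x y : Fin D → ℝ}, x ∈ compl a c → y ∈ compl a c →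
        connectedComponentIn (compl a c) x = connectedComponentIn (compl a c) y →
        pattern a c x ⊆ pattern a c y := by
      intro x y hx hy h n hn
      rw [mem_pattern] at hn ⊢
      by_contra! hlt
      obtain ⟨z, hz, hzc⟩ := (isPreconnected_connectedComponentIn
        (F := compl a c) (x := x)).intermediate_value
        (h ▸ mem_connectedComponentIn hy) (mem_connectedComponentIn hx)
        (f := fun z => ∑ i, a n i * z i) (by fun_prop) ⟨hlt, hn.le⟩
      exact connectedComponentIn_subset _ _ hz n hzc
    exact (key hx hy h).antisymm (key hy hx h.symm)
  · intro h
    apply connectedComponentIn_eq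
    have hseg : segment ℝ x y ⊆ compl a c := by
      rintro _ ⟨s, t, hs, ht, hst, rfl⟩ n
      have hsum : ∑ i, a n i * (s • x + t • y) i =
          s * ∑ i, a n i * x i + t * ∑ i, a n i * y i := by
        rw [sum_mul_add_smul]
        simp [Finset.mul_sum, mul_left_comm]
      have hiff : c n < ∑ i, a n i * x i ↔ c n < ∑ i, a n i * y i := by
        rw [← mem_pattern, h, mem_pattern]
      rw [hsum]
      have hxn := hx n
      have hyn := hy n
      generalize ∑ i, a n i * x i = p at *
      generalize ∑ i, a n i * y i = q at *
      obtain rfl : s = 1 - t := by linarith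
      intro he
      rcases lt_or_gt_of_ne hxn with h1 | h1
      · have h2 : q < c n := lt_of_le_of_ne (not_lt.1 fun h' => (hiff.2 h').not_gt h1) hyn
        rcases hs.eq_or_lt with h0 | h0
        · obtain rfl : t = 1 := by linarith
          linarith
        · nlinarith
      · have h2 := hiff.1 h1
        rcases hs.eq_or_lt with h0 | h0
        · obtain rfl : t = 1 := by linarith
          linarith
        · nlinarith
    exact (convex_segment x y).isPreconnected.subset_connectedComponentIn
      (left_mem_segment ℝ x y) hseg (right_mem_segment ℝ x y)

theorem card_le_of_shatters {s : Finset (Fin N)}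
    (hs : ∀ t ⊆ s, ∃ x ∈ compl a c, s ∩ pattern a c x = t) : s.card ≤ D := by
  by_contra! hcard
  have hdep : ¬ LinearIndependent ℝ fun n : s => a n := fun hli => by
    have := hli.fintype_card_le_finrank
    simp at this
    omega
  obtain ⟨l, hl, k, hk⟩ := Fintype.not_linearIndependent_iff.1 hdep
  have key : ∀ l : s → ℝ, ∑ n, l n • a n = 0 → (∃ k, l k ≠ 0) → 0 < ∑ n, l n * c n := by
    rintro l hl ⟨k, hk⟩
    obtain ⟨x, hx, hxs⟩ := hs (s.filter fun n => ∃ h : n ∈ s, l ⟨n, h⟩ < 0)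
      (Finset.filter_subset _ _)
    have hsum : ∑ n : s, l n * ∑ i, a n i * x i = 0 := by
      simp_rw [Finset.mul_sum]
      rw [Finset.sum_comm]
      refine Finset.sum_eq_zero fun i _ => ?_
      have := congrFun hl i
      simp only [Finset.sum_apply, Pi.smul_apply, smul_eq_mul, Pi.zero_apply] at this
      simp_rw [← mul_assoc]
      rw [← Finset.sum_mul, this, zero_mul]
    have hiff : ∀ n : s, c n < ∑ i, a n i * x i ↔ l n < 0 := by
      intro n
      have := Finset.ext_iff.1 hxs n
      simpa [mem_pattern] using this
    rw [← hsum]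
    have hlt : ∀ n : s, l n ≠ 0 → l n * ∑ i, a n i * x i < l n * c n := by
      intro n hn
      rcases lt_or_gt_of_ne hn with h | h
      · exact mul_lt_mul_of_neg_left ((hiff n).2 h) h
      · exact mul_lt_mul_of_pos_left
          (lt_of_le_of_ne (not_lt.1 fun h' => ((hiff n).1 h').not_gt h) (hx n)) h
    refine Finset.sum_lt_sum (fun n _ => ?_) ⟨k, Finset.mem_univ _, hlt k hk⟩
    by_cases hn : l n = 0
    · simp [hn]
    · exact (hlt n hn).le
  have h1 := key l hl ⟨k, hk⟩
  have h2 := key (-l) (by simpa using hl) ⟨k, by simpa using hk⟩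
  simp only [Pi.neg_apply, neg_mul, Finset.sum_neg_distrib] at h2
  linarith

theorem exists_forall_mem_eq {s : Finset (Fin N)} (h : IsSimpleArrangement a c)
    (hs : s.card ≤ D) : ∃ x : Fin D → ℝ, ∀ n ∈ s, ∑ i, a n i * x i = c n := by
  obtain ⟨x₀, V, -, hV⟩ := (h s).1 hs
  exact ⟨x₀, (Set.ext_iff.1 hV x₀).2 (by simp)⟩

theorem exists_forall_mem_direction {s : Finset (Fin N)} (h : IsSimpleArrangement a c)
    (hs : s.card ≤ D) (w : Fin N → ℝ) : ∃ v : Fin D → ℝ, ∀ n ∈ s, ∑ i, a n i * v i = w n := by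
  obtain ⟨x₀, V, hdim, hV⟩ := (h s).1 hs
  have hx₀ : ∀ n ∈ s, ∑ i, a n i * x₀ i = c n := (Set.ext_iff.1 hV x₀).2 (by simp)
  let L : (Fin D → ℝ) →ₗ[ℝ] (s → ℝ) := Matrix.mulVecLin fun n : s => a n
  have hL : ∀ v (n : s), L v n = ∑ i, a n i * v i := fun v n => rfl
  have hker : LinearMap.ker L = V := by
    ext v
    have hv := Set.ext_iff.1 hV (x₀ + (1 : ℝ) • v)
    simp only [Set.mem_ofPred_eq, sum_mul_add_smul] at hv
    rw [one_smul, add_sub_cancel_left] at hv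
    rw [← hv, LinearMap.mem_ker, funext_iff]
    constructor
    · intro h n hn
      have := h ⟨n, hn⟩
      rw [hL] at this
      simp only [Pi.zero_apply] at this
      rw [this, hx₀ n hn]
      ring
    · intro h n
      have := h n n.2
      rw [hx₀ n n.2] at this
      rw [hL, Pi.zero_apply]
      linarith
  have hrank := L.finrank_range_add_finrank_ker
  rw [hker, hdim, Module.finrank_fin_fun] at hrank
  have htop : LinearMap.range L = ⊤ := by
    apply Submodule.eq_top_of_finrank_eq
    simp
    omega
  obtain ⟨v, hv⟩ := LinearMap.range_eq_top.1 htop fun n => w n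
  exact ⟨v, fun n hn => congrFun hv ⟨n, hn⟩⟩

open Filter Topology in
/-- A small step along `v` changes only the signs of the vanishing affine forms. -/
theorem eventually_sign_add_smul (x v : Fin D → ℝ) :
    ∀ᶠ t : ℝ in 𝓝[>] 0, ∀ n, SignType.sign (∑ i, a n i * (x + t • v) i - c n) =
      if ∑ i, a n i * x i = c n then SignType.sign (∑ i, a n i * v i)
      else SignType.sign (∑ i, a n i * x i - c n) := by
  refine eventually_all.2 fun n => ?_
  simp_rw [sum_mul_add_smul]
  split_ifs with h
  · filter_upwards [self_mem_nhdsWithin] with t ht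
    rw [h, add_sub_cancel_left, sign_mul, sign_pos ht, one_mul]
  · have hc : Tendsto (fun t : ℝ => ∑ i, a n i * x i + t * ∑ i, a n i * v i - c n) (𝓝[>] 0)
        (𝓝 (∑ i, a n i * x i - c n)) := by
      refine tendsto_nhdsWithin_of_tendsto_nhds ?_
      refine Continuous.tendsto' (by fun_prop) _ _ (by simp)
    rcases lt_or_gt_of_ne (sub_ne_zero.2 h) with h0 | h0
    · filter_upwards [hc.eventually_lt_const h0] with t ht
      rw [sign_neg ht, sign_neg h0]
    · filter_upwards [hc.eventually_const_lt h0] with t ht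
      rw [sign_pos ht, sign_pos h0]

theorem exists_generic_mem_flat {s : Finset (Fin N)} (h : IsSimpleArrangement a c)
    (hs : s.card ≤ D) : ∃ x : Fin D → ℝ, ∀ n, ∑ i, a n i * x i = c n ↔ n ∈ s := by
  have key : ∀ T : Finset (Fin N), Disjoint T s → ∃ x : Fin D → ℝ,
      (∀ n ∈ s, ∑ i, a n i * x i = c n) ∧ ∀ n ∈ T, ∑ i, a n i * x i ≠ c n := by
    intro T
    induction T using Finset.induction_on with
    | empty => exact fun _ => (exists_forall_mem_eq h hs).imp fun x hx => ⟨hx, by simp⟩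
    | insert m T _ ih =>
      intro hd
      rw [Finset.disjoint_insert_left] at hd
      obtain ⟨hms, hd⟩ := hd
      obtain ⟨x, hxs, hxT⟩ := ih hd
      by_cases hxm : ∑ i, a m i * x i = c m
      · have hcard : (insert m s).card ≤ D := by
          by_contra! hlt
          have hmem : x ∈ {x : Fin D → ℝ | ∀ n ∈ insert m s, ∑ i, a n i * x i = c n} := by
            simpa [hxm] using hxs
          rw [(h _).2 hlt] at hmem
          exact hmem
        obtain ⟨v, hv⟩ := exists_forall_mem_direction h hcard fun n => if n = m then 1 else 0
        obtain ⟨t, ht⟩ := (eventually_sign_add_smul (a := a) (c := c) x v).exists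
        refine ⟨x + t • v, fun n hn => ?_, fun n hn => ?_⟩
        · have := hv n (Finset.mem_insert_of_mem hn)
          rw [if_neg (by rintro rfl; exact hms hn)] at this
          rw [sum_mul_add_smul, this, hxs n hn]
          ring
        · rw [← sub_ne_zero, ← sign_ne_zero, ht n]
          split_ifs with hn'
          · rcases Finset.mem_insert.1 hn with rfl | hn
            · simp [hv n (Finset.mem_insert_self _ _)]
            · exact absurd hn' (hxT n hn)
          · rwa [sign_ne_zero, sub_ne_zero]
      · exact ⟨x, hxs, by simpa [hxm] using hxT⟩
  obtain ⟨x, hx, hx'⟩ := key sᶜ disjoint_compl_left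
  exact ⟨x, fun n => ⟨fun hn => by_contra fun hns => hx' n (Finset.mem_compl.2 hns) hn, hx n⟩⟩

theorem exists_pattern_strongly_shattered {s : Finset (Fin N)} (h : IsSimpleArrangement a c)
    (hs : s.card ≤ D) :
    ∃ t, ∀ u, sᶜ ∩ u = sᶜ ∩ t → ∃ x ∈ compl a c, pattern a c x = u := by
  obtain ⟨x, hx⟩ := exists_generic_mem_flat h hs
  refine ⟨pattern a c x, fun u hu => ?_⟩
  obtain ⟨v, hv⟩ := exists_forall_mem_direction h hs fun n => if n ∈ u then 1 else -1
  obtain ⟨t, ht⟩ := (eventually_sign_add_smul (a := a) (c := c) x v).exists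
  refine ⟨x + t • v, fun n => ?_, ?_⟩
  · rw [← sub_ne_zero, ← sign_ne_zero, ht n]
    split_ifs with hn
    · rw [hv n ((hx n).1 hn)]
      split_ifs <;> simp
    · rwa [sign_ne_zero, sub_ne_zero]
  · ext n
    rw [mem_pattern, ← sub_pos, ← sign_eq_one_iff, ht n]
    split_ifs with hn
    · rw [hv n ((hx n).1 hn)]
      split_ifs with hnu <;> simp [hnu]
    · have := Finset.ext_iff.1 hu n
      rw [hx n] at hn
      simp only [Finset.mem_inter, Finset.mem_compl, hn, not_false_eq_true, true_and,
        mem_pattern] at this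
      rw [this, sign_eq_one_iff, sub_pos]

theorem ncard_pattern_image (h : IsSimpleArrangement a c) :
    (pattern a c '' compl a c).ncard = ∑ d ∈ Finset.range (D + 1), N.choose d := by
  classical
  rw [Set.ncard_eq_toFinset_card']
  have hcount := Finset.card_filter_card_le (Fin N) D
  rw [Fintype.card_fin] at hcount
  rw [← hcount]
  apply le_antisymm
  · refine (Finset.card_le_card_shatterer _).trans (Finset.card_le_card fun s hs => ?_)
    rw [Finset.mem_filter]
    refine ⟨Finset.mem_univ _, card_le_of_shatters (a := a) (c := c) fun t ht => ?_⟩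
    obtain ⟨u, hu, hut⟩ := (Finset.mem_shatterer.1 hs) ht
    obtain ⟨x, hx, rfl⟩ := Set.mem_toFinset.1 hu
    exact ⟨x, hx, hut⟩
  · refine Finset.card_le_card_of_strongly_shattered _ _ fun s hs => ?_
    obtain ⟨t, ht⟩ := exists_pattern_strongly_shattered h (Finset.mem_filter.1 hs).2
    exact ⟨t, fun u hu => Set.mem_toFinset.2 (ht u hu)⟩

end HyperplaneArrangement

/-- Region count of a simple arrangement: the number of connected components
(regions) of the complement `ℝ^D ∖ (h 1 ∪ ⋯ ∪ h N)` of a simple arrangement of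
`N` affine hyperplanes in `ℝ^D` (with `D ≥ 1`) equals `Σ_{d=0}^{D} C(N, d)`. -/
theorem simple_arrangement_region_count (N D : ℕ) (hD : 1 ≤ D)
    (a : Fin N → Fin D → ℝ) (c : Fin N → ℝ)
    (ha : ∀ n, a n ≠ 0) (hsimple : IsSimpleArrangement a c) :
    {C : Set (Fin D → ℝ) |
        ∃ x ∈ {y : Fin D → ℝ | ∀ n, ∑ i, a n i * y i ≠ c n},
          C = connectedComponentIn {y : Fin D → ℝ | ∀ n, ∑ i, a n i * y i ≠ c n} x}.ncard =
      ∑ d ∈ Finset.range (D + 1), Nat.choose N d := by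
  have himage : {C : Set (Fin D → ℝ) |
        ∃ x ∈ HyperplaneArrangement.compl a c,
          C = connectedComponentIn (HyperplaneArrangement.compl a c) x} =
      connectedComponentIn (HyperplaneArrangement.compl a c) '' HyperplaneArrangement.compl a c := by
    ext C
    simp only [Set.mem_ofPred_eq, Set.mem_image, eq_comm]
  refine (congrArg Set.ncard himage).trans ?_
  exact (Set.ncard_image_eq_of_eq_iff fun x hx y hy =>
    HyperplaneArrangement.connectedComponentIn_eq_iff hx hy).trans
    (HyperplaneArrangement.ncard_pattern_image hsimple)
end

section
/- Bounded region count of a simple arrangement: let h_1, …, h_N be affine hyperplanes in ℝ^D (N ≥ 1, D ≥ 1) forming a simple arrangement (in general position). Then the number of bounded connected components of ℝ^D ∖ (h_1 ∪ ⋯ ∪ h_N) equals C(N−1, D). -/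
section GeneralPosition

variable {ι E : Type*} [NormedAddCommGroup E] [NormedSpace ℝ E]

/-- The affine form `x ↦ L n x - c n` whose zero set is the `n`-th hyperplane. -/
def hyperplaneForm (L : ι → E →ₗ[ℝ] ℝ) (c : ι → ℝ) (n : ι) (x : E) : ℝ := L n x - c n

/-- The region of the arrangement containing `x`: the points lying strictly on the same side
of every hyperplane as `x`. -/
def regionOf (L : ι → E →ₗ[ℝ] ℝ) (c : ι → ℝ) (x : E) : Set E :=
  {y | ∀ n, 0 < hyperplaneForm L c n x * hyperplaneForm L c n y}

/-- General position of the hyperplanes `L n x = c n` in dimension `D`, in terms of the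
solvability of subsystems of equations. -/
structure InGeneralPosition (L : ι → E →ₗ[ℝ] ℝ) (c : ι → ℝ) (D : ℕ) : Prop where
  surj : ∀ s : Finset ι, s.card ≤ D → ∀ y : ι → ℝ, ∃ x, ∀ n ∈ s, L n x = y n
  inj : ∀ s : Finset ι, s.card = D → ∀ x, (∀ n ∈ s, L n x = 0) → x = 0
  card_le : ∀ (s : Finset ι) (x : E), (∀ n ∈ s, L n x = c n) → s.card ≤ D

/-- A vertex of the arrangement, on the hyperplanes indexed by `S`, together with the edge
directions dual to the corresponding forms. -/
structure VertexFrame (L : ι → E →ₗ[ℝ] ℝ) (c : ι → ℝ) (S : Finset ι) where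
  vertex : E
  edge : ι → E
  form_vertex : ∀ n ∈ S, hyperplaneForm L c n vertex = 0
  form_vertex_ne : ∀ n ∉ S, hyperplaneForm L c n vertex ≠ 0
  form_edge_self : ∀ n ∈ S, L n (edge n) = 1
  form_edge_of_ne : ∀ n ∈ S, ∀ m ∈ S, m ≠ n → L m (edge n) = 0
  expand : ∀ x, x = vertex + ∑ n ∈ S, hyperplaneForm L c n x • edge n

/-- The point `x` lies in the region at the vertex of `F` on which the absolute value of the
form `ω` is maximal at that vertex. -/
def VertexFrame.IsPeakOf {L : ι → E →ₗ[ℝ] ℝ} {c : ι → ℝ} {S : Finset ι}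
    (F : VertexFrame L c S) (ω : ι) (x : E) : Prop :=
  (∀ n ∉ S, 0 < hyperplaneForm L c n x * hyperplaneForm L c n F.vertex) ∧
    ∀ n ∈ S, hyperplaneForm L c n x * (L ω (F.edge n) * hyperplaneForm L c ω F.vertex) < 0

variable {L : ι → E →ₗ[ℝ] ℝ} {c : ι → ℝ} {D : ℕ} {S T : Finset ι} {ω : ι} {x y : E}

theorem hyperplaneForm_add_smul (n : ι) (v w : E) (t : ℝ) :
    hyperplaneForm L c n (v + t • w) = hyperplaneForm L c n v + t * L n w := by
  simp [hyperplaneForm]; ring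

theorem mul_pos_of_mul_pos_of_mul_pos {p q r : ℝ} (h₁ : 0 < p * q) (h₂ : 0 < r * q) :
    0 < p * r := by
  have hq : q ≠ 0 := by rintro rfl; simp at h₁
  have : 0 < (p * r) * (q * q) := by nlinarith [mul_pos h₁ h₂]
  exact pos_of_mul_pos_left this (mul_self_nonneg q)

theorem mul_nonneg_of_mul_pos_of_mul_nonneg {p q r : ℝ} (h₁ : 0 < p * q) (h₂ : 0 ≤ p * r) :
    0 ≤ q * r := by
  have hp : p ≠ 0 := by rintro rfl; simp at h₁
  have : 0 ≤ (q * r) * (p * p) := by nlinarith [mul_nonneg h₁.le h₂]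
  exact nonneg_of_mul_nonneg_left this (mul_self_pos.2 hp)

theorem mul_nonpos_of_mul_neg_of_mul_nonneg {p q r : ℝ} (h₁ : p * q < 0) (h₂ : 0 ≤ p * r) :
    r * q ≤ 0 := by
  have := mul_nonneg_of_mul_pos_of_mul_nonneg (p := p) (q := -q) (r := r) (by linarith) h₂
  linarith

theorem continuous_hyperplaneForm [FiniteDimensional ℝ E] (n : ι) :
    Continuous (hyperplaneForm L c n) :=
  (LinearMap.continuous_of_finiteDimensional (L n)).sub continuous_const

theorem regionOf_eq_of_mul_pos
    (h : ∀ n, 0 < hyperplaneForm L c n x * hyperplaneForm L c n y) :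
    regionOf L c x = regionOf L c y := by
  ext z
  refine forall_congr' fun n => ⟨fun hz => ?_, fun hz => ?_⟩
  · exact mul_pos_of_mul_pos_of_mul_pos (q := hyperplaneForm L c n x)
      (by linarith [h n]) (by linarith)
  · exact mul_pos_of_mul_pos_of_mul_pos (q := hyperplaneForm L c n y)
      (h n) (by linarith)

theorem mem_regionOf_self (hx : ∀ n, hyperplaneForm L c n x ≠ 0) : x ∈ regionOf L c x :=
  fun n => mul_self_pos.2 (hx n)

theorem convex_regionOf : Convex ℝ (regionOf L c x) := by
  intro y hy z hz s t hs ht hst n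
  have key : hyperplaneForm L c n (s • y + t • z) =
      s * hyperplaneForm L c n y + t * hyperplaneForm L c n z := by
    simp only [hyperplaneForm, map_add, map_smul, smul_eq_mul]
    linear_combination c n * hst
  rw [key]
  have h₁ := hy n
  have h₂ := hz n
  rcases hs.eq_or_lt with rfl | hs'
  · obtain rfl : t = 1 := by linarith
    simpa using h₂
  · nlinarith [mul_pos hs' h₁, mul_nonneg ht h₂.le]

theorem connectedComponentIn_eq_regionOf [FiniteDimensional ℝ E]
    (hx : ∀ n, hyperplaneForm L c n x ≠ 0) :
    connectedComponentIn {y | ∀ n, hyperplaneForm L c n y ≠ 0} x = regionOf L c x := by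
  apply Set.Subset.antisymm
  · intro y hy n
    have hU := connectedComponentIn_subset {y | ∀ n, hyperplaneForm L c n y ≠ 0} x
    have hxC := mem_connectedComponentIn (F := {y | ∀ n, hyperplaneForm L c n y ≠ 0}) hx
    have hconn := isPreconnected_connectedComponentIn
      (F := {y | ∀ n, hyperplaneForm L c n y ≠ 0}) (x := x)
    have hcont := (continuous_hyperplaneForm (L := L) (c := c) n).continuousOn
      (s := connectedComponentIn {y | ∀ n, hyperplaneForm L c n y ≠ 0} x)
    by_contra hneg
    have hx0 := hx n
    have hy0 := hU hy n
    have hlt : hyperplaneForm L c n x * hyperplaneForm L c n y < 0 :=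
      lt_of_le_of_ne (not_lt.1 hneg) (mul_ne_zero hx0 hy0)
    rcases mul_neg_iff.1 hlt with ⟨h₁, h₂⟩ | ⟨h₁, h₂⟩
    · obtain ⟨z, hz, hz0⟩ := hconn.intermediate_value hy hxC hcont ⟨h₂.le, h₁.le⟩
      exact hU hz n hz0
    · obtain ⟨z, hz, hz0⟩ := hconn.intermediate_value hxC hy hcont ⟨h₁.le, h₂.le⟩
      exact hU hz n hz0
  · refine convex_regionOf.isPreconnected.subset_connectedComponentIn (mem_regionOf_self hx) ?_
    intro y hy n hn
    have := hy n
    simp [hn] at this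

theorem exists_pos_forall_mul_pos [Finite ι] {v : E}
    (hv : ∀ n ∉ S, hyperplaneForm L c n v ≠ 0) (w : E) :
    ∃ ε : ℝ, 0 < ε ∧ ∀ n ∉ S,
      0 < hyperplaneForm L c n (v + ε • w) * hyperplaneForm L c n v := by
  have h : ∀ᶠ ε : ℝ in nhdsWithin 0 (Set.Ioi 0), ∀ n, n ∉ S →
      0 < hyperplaneForm L c n (v + ε • w) * hyperplaneForm L c n v := by
    refine Filter.eventually_all.2 fun n => ?_
    by_cases hn : n ∈ S
    · exact Filter.Eventually.of_forall fun _ h => absurd hn h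
    · simp only [hyperplaneForm_add_smul]
      have hc : Continuous fun ε : ℝ =>
          (hyperplaneForm L c n v + ε * L n w) * hyperplaneForm L c n v := by fun_prop
      have := (hc.tendsto 0).eventually_const_lt
        (u := 0) (by simpa using hv n hn)
      filter_upwards [nhdsWithin_le_nhds this] with ε hε _ using hε
  obtain ⟨ε, hε, hpos⟩ := (h.and self_mem_nhdsWithin).exists
  exact ⟨ε, hpos, hε⟩

theorem InGeneralPosition.form_ne_zero_of_notMem (h : InGeneralPosition L c D)
    (hS : S.card = D) {v : E} (hv : ∀ n ∈ S, hyperplaneForm L c n v = 0) {n : ι} (hn : n ∉ S) :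
    hyperplaneForm L c n v ≠ 0 := by
  classical
  intro h0
  have := h.card_le (insert n S) v (by
    intro m hm
    rcases Finset.mem_insert.1 hm with rfl | hm
    · exact sub_eq_zero.1 h0
    · exact sub_eq_zero.1 (hv m hm))
  rw [Finset.card_insert_of_notMem hn] at this
  omega

theorem InGeneralPosition.nonempty_vertexFrame (h : InGeneralPosition L c D)
    (hS : S.card = D) : Nonempty (VertexFrame L c S) := by
  classical
  obtain ⟨v, hv⟩ := h.surj S hS.le c
  choose w hw using fun n => h.surj S hS.le (Pi.single n 1)
  have hv' : ∀ n ∈ S, hyperplaneForm L c n v = 0 := fun n hn => sub_eq_zero.2 (hv n hn)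
  refine ⟨⟨v, w, hv', fun n hn => h.form_ne_zero_of_notMem hS hv' hn,
    fun n hn => by simp [hw n n hn], fun n _ m hm hmn => by simp [hw n m hm, hmn],
    fun x => ?_⟩⟩
  refine sub_eq_zero.1 (h.inj S hS _ fun m hm => ?_)
  have : ∑ n ∈ S, hyperplaneForm L c n x * L m (w n) = hyperplaneForm L c m x := by
    rw [Finset.sum_eq_single_of_mem m hm]
    · simp [hw m m hm]
    · intro n _ hnm
      simp [hw n m hm, hnm.symm]
  simp only [map_sub, map_add, map_sum, map_smul, smul_eq_mul, this, hv m hm]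
  simp [hyperplaneForm]

namespace VertexFrame

theorem form_eq (F : VertexFrame L c S) (m : ι) (x : E) :
    hyperplaneForm L c m x = hyperplaneForm L c m F.vertex +
      ∑ n ∈ S, hyperplaneForm L c n x * L m (F.edge n) := by
  have := congrArg (L m) (F.expand x)
  simp only [map_add, map_sum, map_smul, smul_eq_mul] at this
  rw [hyperplaneForm, this, hyperplaneForm]
  ring

theorem form_edge_ne_zero (h : InGeneralPosition L c D) (hS : S.card = D) (hω : ω ∉ S)
    (F : VertexFrame L c S) {n : ι} (hn : n ∈ S) : L ω (F.edge n) ≠ 0 := by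
  classical
  intro h0
  have hcard : (insert ω (S.erase n)).card = D := by
    rw [Finset.card_insert_of_notMem (fun hm => hω (Finset.mem_of_mem_erase hm)),
      Finset.card_erase_add_one hn, hS]
  have hz := h.inj _ hcard (F.edge n) (by
    intro m hm
    rcases Finset.mem_insert.1 hm with rfl | hm
    · exact h0
    · exact F.form_edge_of_ne n hn m (Finset.mem_of_mem_erase hm) (Finset.ne_of_mem_erase hm))
  have h1 := F.form_edge_self n hn
  simp [hz] at h1

theorem exists_isPeakOf [Finite ι] (h : InGeneralPosition L c D) (hS : S.card = D) (hω : ω ∉ S)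
    (F : VertexFrame L c S) : ∃ x, F.IsPeakOf ω x := by
  obtain ⟨w, hw⟩ := h.surj S hS.le
    fun n => -(L ω (F.edge n) * hyperplaneForm L c ω F.vertex)
  obtain ⟨ε, hε, hpos⟩ := exists_pos_forall_mul_pos F.form_vertex_ne w
  refine ⟨F.vertex + ε • w, hpos, fun n hn => ?_⟩
  rw [hyperplaneForm_add_smul, F.form_vertex n hn, hw n hn]
  have := mul_self_pos.2
    (mul_ne_zero (F.form_edge_ne_zero h hS hω hn) (F.form_vertex_ne ω hω))
  nlinarith [mul_pos hε this]

variable {F : VertexFrame L c S}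

theorem IsPeakOf.form_ne_zero (hx : F.IsPeakOf ω x) (n : ι) : hyperplaneForm L c n x ≠ 0 := by
  intro h0
  by_cases hn : n ∈ S
  · simpa [h0] using hx.2 n hn
  · simpa [h0] using hx.1 n hn

theorem IsPeakOf.form_mul_form_pos (hx : F.IsPeakOf ω x) (hy : F.IsPeakOf ω y) (n : ι) :
    0 < hyperplaneForm L c n x * hyperplaneForm L c n y := by
  by_cases hn : n ∈ S
  · have h₁ := hx.2 n hn
    have h₂ := hy.2 n hn
    exact mul_pos_of_mul_pos_of_mul_pos
      (q := -(L ω (F.edge n) * hyperplaneForm L c ω F.vertex)) (by linarith) (by linarith)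
  · exact mul_pos_of_mul_pos_of_mul_pos (hx.1 n hn) (hy.1 n hn)

theorem IsPeakOf.of_mem_regionOf (hx : F.IsPeakOf ω x) (hy : y ∈ regionOf L c x) :
    F.IsPeakOf ω y := by
  refine ⟨fun n hn => ?_, fun n hn => ?_⟩
  · exact mul_pos_of_mul_pos_of_mul_pos (q := hyperplaneForm L c n x)
      (by linarith [hy n]) (by linarith [hx.1 n hn])
  · have := mul_pos_of_mul_pos_of_mul_pos (q := hyperplaneForm L c n x)
      (p := hyperplaneForm L c n y)
      (r := -(L ω (F.edge n) * hyperplaneForm L c ω F.vertex))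
      (by linarith [hy n]) (by linarith [hx.2 n hn])
    linarith

theorem isBounded_regionOf (h : InGeneralPosition L c D) (hS : S.card = D) (hω : ω ∉ S)
    (hx : F.IsPeakOf ω x) : Bornology.IsBounded (regionOf L c x) := by
  set g := hyperplaneForm L c ω F.vertex with hg
  refine isBounded_iff_forall_norm_le.2
    ⟨‖F.vertex‖ + ∑ n ∈ S, |g| / |L ω (F.edge n)| * ‖F.edge n‖, fun y hy => ?_⟩
  have hyp := hx.of_mem_regionOf hy
  have hg0 : g ≠ 0 := F.form_vertex_ne ω hω
  have hcoord : ∀ n ∈ S, |hyperplaneForm L c n y| ≤ |g| / |L ω (F.edge n)| := by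
    intro n hn
    have hle : ∀ m ∈ S, 0 ≤ -(hyperplaneForm L c m y * (L ω (F.edge m) * g)) := fun m hm => by
      linarith [hyp.2 m hm]
    have hsum := Finset.single_le_sum hle hn
    have hpos := hyp.1 ω hω
    rw [F.form_eq ω y, ← hg, add_mul, Finset.sum_mul] at hpos
    simp only [mul_assoc, Finset.sum_neg_distrib] at hpos hsum
    have hbound : |hyperplaneForm L c n y| * |L ω (F.edge n)| * |g| ≤ |g| * |g| := by
      rw [← abs_mul, ← abs_mul, ← abs_mul, abs_of_nonneg (mul_self_nonneg g), mul_assoc,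
        abs_of_nonpos (hyp.2 n hn).le]
      linarith
    rw [le_div_iff₀ (abs_pos.2 (F.form_edge_ne_zero h hS hω hn))]
    exact le_of_mul_le_mul_right hbound (abs_pos.2 hg0)
  conv_lhs => rw [F.expand y]
  refine (norm_add_le _ _).trans (add_le_add le_rfl ((norm_sum_le _ _).trans ?_))
  refine Finset.sum_le_sum fun n hn => ?_
  rw [norm_smul, Real.norm_eq_abs]
  exact mul_le_mul_of_nonneg_right (hcoord n hn) (norm_nonneg _)

theorem IsPeakOf.form_mul_form_vertex_nonneg (hx : F.IsPeakOf ω x) (n : ι) :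
    0 ≤ hyperplaneForm L c n x * hyperplaneForm L c n F.vertex := by
  by_cases hn : n ∈ S
  · simp [F.form_vertex n hn]
  · exact (hx.1 n hn).le

variable {G : VertexFrame L c T}

theorem IsPeakOf.term_nonpos (hF : F.IsPeakOf ω x) (hG : G.IsPeakOf ω x) {n : ι} (hn : n ∈ S) :
    hyperplaneForm L c n G.vertex * (L ω (F.edge n) * hyperplaneForm L c ω F.vertex) ≤ 0 :=
  mul_nonpos_of_mul_neg_of_mul_nonneg (hF.2 n hn) (hG.form_mul_form_vertex_nonneg n)

theorem form_vertex_mul_form_vertex (F : VertexFrame L c S) (G : VertexFrame L c T) (ω : ι) :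
    hyperplaneForm L c ω G.vertex * hyperplaneForm L c ω F.vertex =
      hyperplaneForm L c ω F.vertex * hyperplaneForm L c ω F.vertex + ∑ n ∈ S,
        hyperplaneForm L c n G.vertex * (L ω (F.edge n) * hyperplaneForm L c ω F.vertex) := by
  conv_lhs => rw [F.form_eq ω G.vertex, add_mul, Finset.sum_mul]
  simp only [mul_assoc]

theorem IsPeakOf.form_vertex_mul_le (hF : F.IsPeakOf ω x) (hG : G.IsPeakOf ω x) :
    hyperplaneForm L c ω G.vertex * hyperplaneForm L c ω F.vertex ≤
      hyperplaneForm L c ω F.vertex * hyperplaneForm L c ω F.vertex := by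
  rw [form_vertex_mul_form_vertex]
  linarith [Finset.sum_nonpos fun n hn => hF.term_nonpos hG (n := n) hn]

theorem IsPeakOf.subset (h : InGeneralPosition L c D) (hS : S.card = D) (hωS : ω ∉ S)
    (hωT : ω ∉ T) (hF : F.IsPeakOf ω x) (hG : G.IsPeakOf ω x) : S ⊆ T := by
  have h₁ := hF.form_vertex_mul_le hG
  have h₂ := hG.form_vertex_mul_le hF
  have h₃ : 0 < hyperplaneForm L c ω G.vertex * hyperplaneForm L c ω F.vertex :=
    mul_pos_of_mul_pos_of_mul_pos (q := hyperplaneForm L c ω x)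
      (by linarith [hG.1 ω hωT]) (by linarith [hF.1 ω hωS])
  have heq : hyperplaneForm L c ω G.vertex = hyperplaneForm L c ω F.vertex := by
    have : (hyperplaneForm L c ω G.vertex - hyperplaneForm L c ω F.vertex) ^ 2 ≤ 0 := by
      rcases mul_pos_iff.1 h₃ with ⟨hg, hf⟩ | ⟨hg, hf⟩ <;> nlinarith
    exact sub_eq_zero.1 (pow_eq_zero_iff two_ne_zero |>.1 (le_antisymm this (sq_nonneg _)))
  have hsum := form_vertex_mul_form_vertex F G ω
  rw [heq, left_eq_add] at hsum
  intro n hn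
  have hterm := (Finset.sum_eq_zero_iff_of_nonpos fun n hn => hF.term_nonpos hG hn).1 hsum n hn
  by_contra hnT
  exact mul_ne_zero (G.form_vertex_ne n hnT) (mul_ne_zero (F.form_edge_ne_zero h hS hωS hn)
    (F.form_vertex_ne ω hωS)) hterm

end VertexFrame

theorem closedRegion_subset_closure (hx : ∀ n, hyperplaneForm L c n x ≠ 0) :
    {y | ∀ n, 0 ≤ hyperplaneForm L c n x * hyperplaneForm L c n y} ⊆
      closure (regionOf L c x) := by
  intro y hy
  have hc : Continuous fun t : ℝ => y + t • (x - y) := by fun_prop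
  have ht : Filter.Tendsto (fun t : ℝ => y + t • (x - y)) (nhdsWithin 0 (Set.Ioi 0)) (nhds y) := by
    have := hc.tendsto 0
    simp only [zero_smul, add_zero] at this
    exact this.mono_left nhdsWithin_le_nhds
  refine mem_closure_of_tendsto ht ?_
  filter_upwards [Ioo_mem_nhdsGT (zero_lt_one (α := ℝ))] with t ht n
  have hxy : L n (x - y) = hyperplaneForm L c n x - hyperplaneForm L c n y := by
    simp [hyperplaneForm]
  rw [hyperplaneForm_add_smul, hxy]
  nlinarith [mul_pos ht.1 (mul_self_pos.2 (hx n)),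
    mul_nonneg (sub_nonneg.2 ht.2.le) (hy n)]

theorem InGeneralPosition.exists_peak [Fintype ι] [FiniteDimensional ℝ E]
    (h : InGeneralPosition L c D) (ω : ι) (hx : ∀ n, hyperplaneForm L c n x ≠ 0)
    (hb : Bornology.IsBounded (regionOf L c x)) :
    ∃ S : Finset ι, S.card = D ∧ ω ∉ S ∧ ∀ F : VertexFrame L c S, F.IsPeakOf ω x := by
  classical
  set P := {y | ∀ n, 0 ≤ hyperplaneForm L c n x * hyperplaneForm L c n y} with hP
  have hPclosed : IsClosed P := by
    rw [hP, Set.ofPred_forall]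
    exact isClosed_iInter fun n => isClosed_le continuous_const
      (continuous_const.mul (continuous_hyperplaneForm n))
  have : ProperSpace E := FiniteDimensional.proper ℝ E
  have hPcompact : IsCompact P := Metric.isCompact_of_isClosed_isBounded hPclosed
    (hb.closure.subset (closedRegion_subset_closure hx))
  have hxP : x ∈ P := fun n => mul_self_nonneg _
  obtain ⟨v, hvP, hmax⟩ := hPcompact.exists_isMaxOn ⟨x, hxP⟩
    (continuous_const.mul (continuous_hyperplaneForm (L := L) (c := c) ω) :
      Continuous fun y => hyperplaneForm L c ω x * hyperplaneForm L c ω y).continuousOn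
  have hvω : 0 < hyperplaneForm L c ω x * hyperplaneForm L c ω v :=
    (mul_self_pos.2 (hx ω)).trans_le (hmax hxP)
  let S : Finset ι := Finset.univ.filter fun n => hyperplaneForm L c n v = 0
  have hmem : ∀ n, n ∈ S ↔ hyperplaneForm L c n v = 0 := fun n => by simp [S]
  have hωS : ω ∉ S := fun hω => by simp [(hmem ω).1 hω] at hvω
  have hoff : ∀ n ∉ S, 0 < hyperplaneForm L c n x * hyperplaneForm L c n v := fun n hn =>
    lt_of_le_of_ne (hvP n) (mul_ne_zero (hx n) (mt (hmem n).2 hn)).symm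
  have hdir : ∀ w : E, (∀ n ∈ S, 0 ≤ hyperplaneForm L c n x * L n w) →
      hyperplaneForm L c ω x * L ω w ≤ 0 := by
    intro w hw
    obtain ⟨ε, hε, hpos⟩ := exists_pos_forall_mul_pos (fun n hn => mt (hmem n).2 hn) w
    have hmem' : v + ε • w ∈ P := by
      intro n
      by_cases hn : n ∈ S
      · rw [hyperplaneForm_add_smul, (hmem n).1 hn]
        nlinarith [mul_nonneg hε.le (hw n hn)]
      · exact (mul_pos_of_mul_pos_of_mul_pos (hoff n hn) (hpos n hn)).le
    have hle : hyperplaneForm L c ω x * hyperplaneForm L c ω (v + ε • w) ≤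
      hyperplaneForm L c ω x * hyperplaneForm L c ω v := hmax hmem'
    rw [hyperplaneForm_add_smul] at hle
    have : ε * (hyperplaneForm L c ω x * L ω w) ≤ 0 := by linarith
    exact nonpos_of_mul_nonpos_right this hε
  have hcard : S.card = D := by
    refine le_antisymm (h.card_le S v fun n hn => sub_eq_zero.1 ((hmem n).1 hn)) ?_
    by_contra! hlt
    obtain ⟨w, hw⟩ := h.surj (insert ω S)
      (by rw [Finset.card_insert_of_notMem hωS]; omega)
      (Pi.single ω (hyperplaneForm L c ω x))
    have := hdir w fun n hn => by
      rw [hw n (Finset.mem_insert_of_mem hn), Pi.single_eq_of_ne (by rintro rfl; exact hωS hn),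
        mul_zero]
    rw [hw ω (Finset.mem_insert_self _ _), Pi.single_eq_same] at this
    exact absurd this (not_le.2 (mul_self_pos.2 (hx ω)))
  refine ⟨S, hcard, hωS, fun F => ?_⟩
  have hvF : v = F.vertex := by
    have hsum : ∑ n ∈ S, hyperplaneForm L c n v • F.edge n = 0 :=
      Finset.sum_eq_zero fun n hn => by rw [(hmem n).1 hn, zero_smul]
    have := F.expand v
    rwa [hsum, add_zero] at this
  refine ⟨hvF ▸ hoff, fun n hn => ?_⟩
  have hle := hdir (hyperplaneForm L c n x • F.edge n) fun m hm => by
    rw [map_smul, smul_eq_mul]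
    by_cases hmn : m = n
    · subst hmn
      rw [F.form_edge_self m hm, mul_one]
      exact mul_self_nonneg _
    · rw [F.form_edge_of_ne n hn m hm hmn]
      simp
  rw [map_smul, smul_eq_mul] at hle
  have hlt : hyperplaneForm L c ω x * (hyperplaneForm L c n x * L ω (F.edge n)) < 0 :=
    lt_of_le_of_ne hle
      (mul_ne_zero (hx ω) (mul_ne_zero (hx n) (F.form_edge_ne_zero h hcard hωS hn)))
  have := mul_pos_of_mul_pos_of_mul_pos (q := hyperplaneForm L c ω x)
    (p := -(hyperplaneForm L c n x * L ω (F.edge n))) (r := hyperplaneForm L c ω F.vertex)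
    (by linarith) (by rw [← hvF]; linarith)
  linarith

theorem InGeneralPosition.ncard_bounded_regions [Fintype ι] [FiniteDimensional ℝ E]
    (h : InGeneralPosition L c D) (ω : ι) :
    {C : Set E | (∃ x, (∀ n, hyperplaneForm L c n x ≠ 0) ∧ C = regionOf L c x) ∧
      Bornology.IsBounded C}.ncard = (Fintype.card ι - 1).choose D := by
  classical
  have hpc : ∀ S ∈ Finset.powersetCard D (Finset.univ.erase ω), S.card = D ∧ ω ∉ S := by
    intro S hS
    rw [Finset.mem_powersetCard] at hS
    exact ⟨hS.2, fun hω => Finset.notMem_erase ω _ (hS.1 hω)⟩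
  choose F x hFx using fun S hS => (h.nonempty_vertexFrame (hpc S hS).1).elim fun F =>
    (F.exists_isPeakOf h (hpc S hS).1 (hpc S hS).2).elim fun x hx =>
      (⟨F, x, hx⟩ : ∃ F : VertexFrame L c S, ∃ x, F.IsPeakOf ω x)
  have hcard : (Finset.powersetCard D (Finset.univ.erase ω) : Set (Finset ι)).ncard =
      (Fintype.card ι - 1).choose D := by
    rw [Set.ncard_coe_finset, Finset.card_powersetCard, Finset.card_erase_of_mem
      (Finset.mem_univ ω), Finset.card_univ]
  rw [← hcard]
  refine (Set.ncard_congr (fun S hS => regionOf L c (x S hS)) ?_ ?_ ?_).symm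
  · intro S hS
    exact ⟨⟨_, (hFx S hS).form_ne_zero, rfl⟩,
      VertexFrame.isBounded_regionOf h (hpc S hS).1 (hpc S hS).2 (hFx S hS)⟩
  · intro S T hS hT hST
    have hmem : x T hT ∈ regionOf L c (x S hS) :=
      hST ▸ mem_regionOf_self (hFx T hT).form_ne_zero
    exact Finset.eq_of_subset_of_card_le
      (((hFx S hS).of_mem_regionOf hmem).subset h (hpc S hS).1 (hpc S hS).2 (hpc T hT).2
        (hFx T hT)) ((hpc T hT).1.trans (hpc S hS).1.symm).le
  · rintro _ ⟨⟨y, hy, rfl⟩, hb⟩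
    obtain ⟨S, hS, hω, hpeak⟩ := h.exists_peak ω hy hb
    have hSmem : S ∈ Finset.powersetCard D (Finset.univ.erase ω) :=
      Finset.mem_powersetCard.2 ⟨fun n hn => Finset.mem_erase.2
        ⟨by rintro rfl; exact hω hn, Finset.mem_univ n⟩, hS⟩
    exact ⟨S, hSmem, regionOf_eq_of_mul_pos
      ((hFx S hSmem).form_mul_form_pos (hpeak (F S hSmem)))⟩

end GeneralPosition

theorem IsSimpleArrangement.inGeneralPosition {N D : ℕ} {a : Fin N → Fin D → ℝ} {c : Fin N → ℝ}
    (hsimple : IsSimpleArrangement a c) :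
    InGeneralPosition (fun n => (LinearMap.proj n).comp (Matrix.mulVecLin (Matrix.of a))) c D := by
  have key : ∀ s : Finset (Fin N), s.card ≤ D → Module.finrank ℝ (LinearMap.ker
      (LinearMap.pi fun n : s => (LinearMap.proj (n : Fin N)).comp
        (Matrix.mulVecLin (Matrix.of a)))) = D - s.card := by
    intro s hs
    obtain ⟨x₀, V, hV, hset⟩ := (hsimple s).1 hs
    suffices hker : LinearMap.ker (LinearMap.pi fun n : s => (LinearMap.proj (n : Fin N)).comp
        (Matrix.mulVecLin (Matrix.of a))) = V by rw [hker, hV]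
    have hx₀ : ∀ n ∈ s, ∑ i, a n i * x₀ i = c n := by
      have : x₀ ∈ {x | x - x₀ ∈ V} := by simp
      rwa [← hset] at this
    ext w
    have hw := Set.ext_iff.1 hset (w + x₀)
    simp only [Set.mem_ofPred_eq, add_sub_cancel_right] at hw
    rw [← hw, LinearMap.mem_ker, funext_iff, Subtype.forall]
    refine forall₂_congr fun n hn => ?_
    simp [Matrix.mulVec, dotProduct, mul_add, Finset.sum_add_distrib, hx₀ n hn]
  refine ⟨fun s hs y => ?_, fun s hs x hx => ?_, fun s x hx => ?_⟩
  · set M := LinearMap.pi fun n : s => (LinearMap.proj (n : Fin N)).comp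
      (Matrix.mulVecLin (Matrix.of a))
    have hrank := LinearMap.finrank_range_add_finrank_ker M
    rw [key s hs, Module.finrank_fin_fun] at hrank
    have htop : LinearMap.range M = ⊤ := by
      apply Submodule.eq_top_of_finrank_eq
      rw [Module.finrank_fintype_fun_eq_card, Fintype.card_coe]
      omega
    obtain ⟨x, hx⟩ := LinearMap.range_eq_top.1 htop fun n => y n
    exact ⟨x, fun n hn => congrFun hx ⟨n, hn⟩⟩
  · have hker := key s hs.le
    rw [hs, Nat.sub_self, Submodule.finrank_eq_zero] at hker
    have : x ∈ LinearMap.ker (LinearMap.pi fun n : s => (LinearMap.proj (n : Fin N)).comp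
        (Matrix.mulVecLin (Matrix.of a))) :=
      LinearMap.mem_ker.2 (funext fun n => hx n n.2)
    rwa [hker, Submodule.mem_bot] at this
  · by_contra! hlt
    have : x ∈ {x : Fin D → ℝ | ∀ n ∈ s, ∑ i, a n i * x i = c n} := hx
    rw [(hsimple s).2 hlt] at this
    exact this

/-- Bounded region count of a simple arrangement: the number of bounded
connected components (bounded regions) of the complement
`ℝ^D ∖ (h 1 ∪ ⋯ ∪ h N)` of a simple arrangement of `N ≥ 1` affine hyperplanes
in `ℝ^D` (with `D ≥ 1`) equals `C(N−1, D)`. -/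
theorem simple_arrangement_bounded_region_count (N D : ℕ) (hN : 1 ≤ N) (hD : 1 ≤ D)
    (a : Fin N → Fin D → ℝ) (c : Fin N → ℝ)
    (ha : ∀ n, a n ≠ 0) (hsimple : IsSimpleArrangement a c) :
    {C : Set (Fin D → ℝ) |
        (∃ x ∈ {y : Fin D → ℝ | ∀ n, ∑ i, a n i * y i ≠ c n},
          C = connectedComponentIn {y : Fin D → ℝ | ∀ n, ∑ i, a n i * y i ≠ c n} x) ∧
        Bornology.IsBounded C}.ncard =
      Nat.choose (N - 1) D := by
  have h := hsimple.inGeneralPosition.ncard_bounded_regions (⟨0, hN⟩ : Fin N)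
  rw [Fintype.card_fin] at h
  have hU : {y : Fin D → ℝ | ∀ n, ∑ i, a n i * y i ≠ c n} = {y | ∀ n, hyperplaneForm
      (fun n => (LinearMap.proj n).comp (Matrix.mulVecLin (Matrix.of a))) c n y ≠ 0} :=
    Set.ext fun y => forall_congr' fun n => not_congr sub_eq_zero.symm
  rw [← h, hU]
  congr 1
  ext C
  refine and_congr_left' (exists_congr fun x => and_congr_right fun hx => ?_)
  rw [connectedComponentIn_eq_regionOf hx]
end
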